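/- Let λ₁ > 0, let ξ be standard Gaussian, and let f(x) = exp(−x/(2λ₁))/√(2πλ₁x) for x > 0 be the density of λ₁ξ². If F = F₁ * f is the convolution of a distribution function F₁ (of a nonnegative random variable) with f, then F₁(r) = √(2λ₁/π)·exp(−r/(2λ₁))·∫₀^r (F(x)exp(x/(2λ₁)))' dx/√(r−x). -/

import Mathlib

open MeasureTheory Real

/-- The kernel `t ↦ 1/√t` on `(0, ∞)`, extended by zero to the left half-line. -/
noncomputable def abelKernel (t : ℝ) : ENNReal := ENNReal.ofReal (√t)⁻¹

theorem measurable_abelKernel : Measurable abelKernel := by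
  unfold abelKernel; fun_prop

theorem abelKernel_of_nonpos {t : ℝ} (ht : t ≤ 0) : abelKernel t = 0 := by
  simp [abelKernel, Real.sqrt_eq_zero_of_nonpos ht]

theorem hasDerivAt_arcsin_affine {a x : ℝ} (hx : x ∈ Set.Ioo 0 a) :
    HasDerivAt (fun x => arcsin ((2 * x - a) / a)) ((√(a - x))⁻¹ * (√x)⁻¹) x := by
  obtain ⟨h0, h1⟩ := hx
  have ha : 0 < a := h0.trans h1
  have hl : HasDerivAt (fun x : ℝ => (2 * x - a) / a) (2 / a) x := by
    simpa using (((hasDerivAt_id x).const_mul 2).sub_const a).div_const a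
  have hne : (2 * x - a) / a ≠ -1 := by
    rw [Ne, div_eq_iff ha.ne']; intro h; linarith
  have hne' : (2 * x - a) / a ≠ 1 := by
    rw [Ne, div_eq_iff ha.ne']; intro h; linarith
  refine ((hasDerivAt_arcsin hne hne').comp x hl).congr_deriv ?_
  have hs : 1 - ((2 * x - a) / a) ^ 2 = (2 / a) ^ 2 * ((a - x) * x) := by
    field_simp; ring
  rw [hs, Real.sqrt_mul (by positivity), Real.sqrt_sq (by positivity),
    Real.sqrt_mul (by linarith)]
  have h2 : √x ≠ 0 := (Real.sqrt_pos.2 h0).ne'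
  have h3 : √(a - x) ≠ 0 := (Real.sqrt_pos.2 (by linarith)).ne'
  field_simp

theorem lintegral_abelKernel_mul_abelKernel {a : ℝ} (ha : 0 < a) :
    ∫⁻ x, abelKernel (a - x) * abelKernel x = ENNReal.ofReal π := by
  have hcont : ContinuousOn (fun x => arcsin ((2 * x - a) / a)) (Set.Icc 0 a) := by
    apply Continuous.continuousOn
    exact Real.continuous_arcsin.comp (by fun_prop)
  have hint : IntegrableOn (fun x => (√(a - x))⁻¹ * (√x)⁻¹) (Set.Ioc 0 a) :=
    intervalIntegral.integrableOn_deriv_of_nonneg hcont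
      (fun x hx => hasDerivAt_arcsin_affine hx) (fun x _ => by positivity)
  have hval : ∫ x in (0 : ℝ)..a, (√(a - x))⁻¹ * (√x)⁻¹ = π := by
    rw [intervalIntegral.integral_eq_sub_of_hasDerivAt_of_le ha.le hcont
      (fun x hx => hasDerivAt_arcsin_affine hx)
      ((intervalIntegrable_iff_integrableOn_Ioc_of_le ha.le).2 hint)]
    have h1 : (2 * a - a) / a = 1 := by field_simp; ring
    have h2 : (2 * 0 - a) / a = -1 := by field_simp; ring
    rw [h1, h2, arcsin_one, arcsin_neg_one]; ring
  have hsupp : ∫⁻ x, abelKernel (a - x) * abelKernel x =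
      ∫⁻ x in Set.Ioc 0 a, abelKernel (a - x) * abelKernel x := by
    rw [← lintegral_indicator measurableSet_Ioc]
    refine lintegral_congr fun x => ?_
    by_cases hx : x ∈ Set.Ioc 0 a
    · simp [hx]
    · rw [Set.indicator_of_notMem hx]
      by_cases h0 : x ≤ 0
      · simp [abelKernel_of_nonpos h0]
      · have : a - x ≤ 0 := by
          simp only [Set.mem_Ioc, not_and, not_le] at hx h0
          linarith [hx h0]
        simp [abelKernel_of_nonpos this]
  rw [hsupp, ← hval, intervalIntegral.integral_of_le ha.le,
    ofReal_integral_eq_lintegral_ofReal hint (Filter.Eventually.of_forall fun x => by positivity)]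
  refine lintegral_congr fun x => ?_
  rw [abelKernel, abelKernel, ENNReal.ofReal_mul (by positivity)]

theorem lintegral_abelKernel_sub_mul_abelKernel_sub (r u : ℝ) :
    ∫⁻ x, abelKernel (r - x) * abelKernel (x - u) =
      (Set.Iio r).indicator (fun _ => ENNReal.ofReal π) u := by
  by_cases hu : u < r
  · rw [Set.indicator_of_mem (Set.mem_Iio.2 hu),
      ← lintegral_abelKernel_mul_abelKernel (sub_pos.2 hu),
      ← lintegral_sub_right_eq_self (fun x => abelKernel (r - u - x) * abelKernel x) u]
    refine lintegral_congr fun x => ?_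
    simp
  · rw [Set.indicator_of_notMem (by simpa using hu), ← lintegral_zero (μ := (volume : Measure ℝ))]
    refine lintegral_congr fun x => ?_
    by_cases hx : x ≤ u
    · simp [abelKernel_of_nonpos (sub_nonpos.2 hx)]
    · rw [abelKernel_of_nonpos (t := r - x) (by linarith)]; simp

/-- The convolution of a measure with `t ↦ 1/√t`. -/
noncomputable def abelTransform (μ : Measure ℝ) (x : ℝ) : ENNReal :=
  ∫⁻ u, abelKernel (x - u) ∂μ

theorem measurable_abelTransform (μ : Measure ℝ) [SFinite μ] : Measurable (abelTransform μ) :=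
  Measurable.lintegral_prod_right' (f := fun p : ℝ × ℝ => abelKernel (p.1 - p.2))
    (measurable_abelKernel.comp (by fun_prop))

theorem lintegral_abelKernel_mul_abelTransform (μ : Measure ℝ) [SFinite μ] (r : ℝ) :
    ∫⁻ x, abelKernel (r - x) * abelTransform μ x = ENNReal.ofReal π * μ (Set.Iio r) := by
  have hk := measurable_abelKernel
  calc ∫⁻ x, abelKernel (r - x) * abelTransform μ x
      = ∫⁻ x, ∫⁻ u, abelKernel (r - x) * abelKernel (x - u) ∂μ := by
        refine lintegral_congr fun x => ?_
        rw [abelTransform, lintegral_const_mul _ (by fun_prop)]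
    _ = ∫⁻ u, (∫⁻ x, abelKernel (r - x) * abelKernel (x - u)) ∂μ := by
        rw [lintegral_lintegral_swap]
        exact Measurable.aemeasurable (by fun_prop)
    _ = ENNReal.ofReal π * μ (Set.Iio r) := by
        simp_rw [lintegral_abelKernel_sub_mul_abelKernel_sub]
        rw [lintegral_indicator measurableSet_Iio, setLIntegral_const]

theorem setLIntegral_Iio_abelTransform (μ : Measure ℝ) [SFinite μ] (r : ℝ) :
    ∫⁻ x in Set.Iio r, abelTransform μ x = ∫⁻ x, μ (Set.Iio (r - x)) * abelKernel x := by
  have hk := measurable_abelKernel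
  have hI : Measurable (fun p : ℝ × ℝ => (Set.Iio r).indicator (1 : ℝ → ENNReal) p.1) :=
    (measurable_one.indicator measurableSet_Iio).comp measurable_fst
  have hI' : Measurable (fun p : ℝ × ℝ => (Set.Iio r).indicator (1 : ℝ → ENNReal) (p.1 + p.2)) :=
    (measurable_one.indicator measurableSet_Iio).comp (measurable_fst.add measurable_snd)
  calc ∫⁻ x in Set.Iio r, abelTransform μ x
      = ∫⁻ x, ∫⁻ u, (Set.Iio r).indicator 1 x * abelKernel (x - u) ∂μ := by
        rw [← lintegral_indicator measurableSet_Iio]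
        refine lintegral_congr fun x => ?_
        rw [lintegral_const_mul _ (by fun_prop)]
        by_cases hx : x ∈ Set.Iio r <;> simp [hx, abelTransform]
    _ = ∫⁻ u, (∫⁻ x, (Set.Iio r).indicator 1 x * abelKernel (x - u)) ∂μ := by
        rw [lintegral_lintegral_swap]
        exact (hI.mul (hk.comp (measurable_fst.sub measurable_snd))).aemeasurable
    _ = ∫⁻ u, (∫⁻ x, (Set.Iio r).indicator 1 (x + u) * abelKernel x) ∂μ := by
        refine lintegral_congr fun u => ?_
        rw [← lintegral_add_right_eq_self _ u]
        simp
    _ = ∫⁻ x, ∫⁻ u, (Set.Iio r).indicator 1 (x + u) * abelKernel x ∂μ := by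
        rw [lintegral_lintegral_swap]
        exact ((hI'.comp measurable_swap).mul (hk.comp measurable_snd)).aemeasurable
    _ = ∫⁻ x, μ (Set.Iio (r - x)) * abelKernel x := by
        refine lintegral_congr fun x => ?_
        have hx : Measurable fun u => (Set.Iio r).indicator (1 : ℝ → ENNReal) (x + u) :=
          hI'.comp measurable_prodMk_left
        rw [lintegral_mul_const _ hx]
        congr 1
        rw [← lintegral_indicator_one measurableSet_Iio]
        refine lintegral_congr fun u => ?_
        simp [Set.indicator_apply, lt_sub_iff_add_lt']

theorem abelTransform_of_nonpos {μ : Measure ℝ} (hμ : μ (Set.Iio 0) = 0) {x : ℝ} (hx : x ≤ 0) :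
    abelTransform μ x = 0 := by
  rw [abelTransform, ← lintegral_zero (μ := μ)]
  refine lintegral_congr_ae ?_
  have h : ∀ᵐ u ∂μ, u ∉ Set.Iio 0 := measure_eq_zero_iff_ae_notMem.1 hμ
  filter_upwards [h] with u hu
  simp only [Set.mem_Iio, not_lt] at hu
  exact abelKernel_of_nonpos (by linarith)

/-- Inversion of Abel's integral equation `G(r) = ∫₀^r g(r - x) / √x dx` for a continuous monotone
function `g` vanishing on the left half-line. -/
theorem integral_deriv_div_sqrt_eq_of_abel {g G : ℝ → ℝ} (hmono : Monotone g)
    (hcont : Continuous g) (hneg : ∀ x ≤ 0, g x = 0)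
    (hG : ∀ r ≥ 0, G r = ∫ x in (0 : ℝ)..r, g (r - x) * (√x)⁻¹) {r : ℝ} (hr : 0 ≤ r) :
    ∫ x in (0 : ℝ)..r, deriv G x / √(r - x) = π * g r := by
  have hnonneg : ∀ x, 0 ≤ g x := fun x => by
    rcases le_total x 0 with h | h
    · rw [hneg x h]
    · rw [← hneg 0 le_rfl]; exact hmono h
  let S : StieltjesFunction ℝ := ⟨g, hmono, fun x => hcont.continuousWithinAt⟩
  have hbot : Filter.Tendsto S Filter.atBot (nhds 0) :=
    tendsto_const_nhds.congr' ((Filter.eventually_le_atBot 0).mono fun x hx => (hneg x hx).symm)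
  have hμ : ∀ x, S.measure (Set.Iio x) = ENNReal.ofReal (g x) := fun x => by
    rw [S.measure_Iio hbot, sub_zero]
    congr 1
    exact hcont.continuousAt.continuousWithinAt.leftLim_eq
  set H := abelTransform S.measure with hH
  have hHm : Measurable H := measurable_abelTransform _
  have hHneg : ∀ x ≤ 0, H x = 0 := fun x hx =>
    abelTransform_of_nonpos (by rw [hμ, hneg 0 le_rfl, ENNReal.ofReal_zero]) hx
  have hGnonneg : ∀ y ≥ 0, 0 ≤ G y := fun y hy => by
    rw [hG y hy]
    exact intervalIntegral.integral_nonneg hy fun x _ => mul_nonneg (hnonneg _) (by positivity)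
  have hlin : ∀ y ≥ 0, ∫⁻ x in Set.Ioc 0 y, H x = ENNReal.ofReal (G y) := fun y hy => by
    have hint : IntervalIntegrable (fun x => g (y - x) * (√x)⁻¹) volume 0 y := by
      have h : IntervalIntegrable (fun x : ℝ => x ^ (-(1 / 2) : ℝ)) volume 0 y :=
        intervalIntegral.intervalIntegrable_rpow' (by norm_num)
      refine IntervalIntegrable.continuousOn_mul ?_ (by fun_prop)
      refine h.congr_uIoo ?_
      intro x hx
      rw [Set.uIoo_of_le hy] at hx
      simp only [Real.rpow_neg hx.1.le, Real.sqrt_eq_rpow]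
    have hL : ∫⁻ x in Set.Iio y, H x = ENNReal.ofReal (G y) := by
      rw [hH, setLIntegral_Iio_abelTransform, hG y hy, intervalIntegral.integral_of_le hy,
        ofReal_integral_eq_lintegral_ofReal hint.1
          (Filter.Eventually.of_forall fun x => mul_nonneg (hnonneg _) (by positivity)),
        ← lintegral_indicator measurableSet_Ioc]
      refine lintegral_congr fun x => ?_
      rw [hμ]
      by_cases hx : x ∈ Set.Ioc 0 y
      · rw [Set.indicator_of_mem hx, ENNReal.ofReal_mul (hnonneg _), abelKernel]
      · rw [Set.indicator_of_notMem hx]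
        by_cases h0 : x ≤ 0
        · simp [abelKernel_of_nonpos h0]
        · have : y - x ≤ 0 := by
            simp only [Set.mem_Ioc, not_and, not_le] at hx h0
            linarith [hx h0]
          simp [hneg _ this]
    rw [← hL, ← setLIntegral_congr (Iio_ae_eq_Iic (a := y)).symm,
      ← lintegral_indicator measurableSet_Ioc, ← lintegral_indicator measurableSet_Iic]
    refine lintegral_congr fun x => ?_
    by_cases h0 : x ≤ 0
    · simp [Set.indicator_apply, hHneg x h0]
    · simp [Set.indicator_apply, not_le.1 h0]
  have hfin : ∀ y ≥ 0, ∀ᵐ x ∂volume.restrict (Set.Ioc 0 y), H x < ⊤ := fun y hy =>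
    ae_lt_top hHm (by rw [hlin y hy]; exact ENNReal.ofReal_ne_top)
  have hprim : ∀ y ≥ 0, ∫ x in (0 : ℝ)..y, (H x).toReal = G y := fun y hy => by
    rw [intervalIntegral.integral_of_le hy, integral_toReal hHm.aemeasurable (hfin y hy),
      hlin y hy, ENNReal.toReal_ofReal (hGnonneg y hy)]
  have hHint : IntervalIntegrable (fun x => (H x).toReal) volume 0 r :=
    (intervalIntegrable_iff_integrableOn_Ioc_of_le hr).2
      (integrable_toReal_of_lintegral_ne_top hHm.aemeasurable
        (by rw [hlin r hr]; exact ENNReal.ofReal_ne_top))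
  have hderiv : ∀ᵐ x, x ∈ Set.Ioc 0 r → deriv G x = (H x).toReal := by
    filter_upwards [hHint.ae_hasDerivAt_integral] with x hx hxr
    rw [Set.uIcc_of_le hr] at hx
    refine (((hx ⟨hxr.1.le, hxr.2⟩ 0 ⟨le_rfl, hr⟩).congr_of_eventuallyEq ?_)).deriv
    filter_upwards [lt_mem_nhds hxr.1] with y hy
    exact (hprim y hy.le).symm
  have hmul : Measurable fun x => abelKernel (r - x) * H x :=
    (measurable_abelKernel.comp (by fun_prop)).mul hHm
  calc ∫ x in (0 : ℝ)..r, deriv G x / √(r - x)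
      = ∫ x in Set.Ioc 0 r, (abelKernel (r - x) * H x).toReal := by
        rw [intervalIntegral.integral_of_le hr]
        refine setIntegral_congr_ae measurableSet_Ioc ?_
        filter_upwards [hderiv] with x hx hxr
        rw [hx hxr, ENNReal.toReal_mul, abelKernel, ENNReal.toReal_ofReal (by positivity),
          div_eq_mul_inv, mul_comm]
    _ = (∫⁻ x in Set.Ioc 0 r, abelKernel (r - x) * H x).toReal := by
        refine integral_toReal hmul.aemeasurable ?_
        filter_upwards [hfin r hr] with x hx
        exact ENNReal.mul_lt_top ENNReal.ofReal_lt_top hx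
    _ = (∫⁻ x, abelKernel (r - x) * H x).toReal := by
        rw [← lintegral_indicator measurableSet_Ioc]
        congr 1
        refine lintegral_congr fun x => ?_
        by_cases hx : x ∈ Set.Ioc 0 r
        · rw [Set.indicator_of_mem hx]
        · rw [Set.indicator_of_notMem hx]
          by_cases h0 : x ≤ 0
          · simp [hHneg x h0]
          · have : r - x ≤ 0 := by
              simp only [Set.mem_Ioc, not_and, not_le] at hx h0
              linarith [hx h0]
            simp [abelKernel_of_nonpos this]
    _ = π * g r := by
        rw [hH, lintegral_abelKernel_mul_abelTransform, hμ, ENNReal.toReal_mul,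
          ENNReal.toReal_ofReal pi_pos.le, ENNReal.toReal_ofReal (hnonneg r)]

open MeasureTheory Real

/-- Inversion of the convolution equation `F = F₁ * f`, where
`f(x) = exp(−x/(2λ₁))/√(2πλ₁x)` is the density of `λ₁ξ²`:
`F₁(r) = √(2λ₁/π) e^{−r/(2λ₁)} ∫₀^r (F(x)e^{x/(2λ₁)})' dx/√(r−x)`. -/
theorem convolution_inversion
    (lam1 : ℝ) (hlam1 : 0 < lam1)
    (f F F₁ : ℝ → ℝ)
    (hf : ∀ x > 0, f x = Real.exp (-x / (2 * lam1)) / Real.sqrt (2 * π * lam1 * x))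
    -- F₁ is the distribution function of a nonnegative random variable
    (hF₁mono : Monotone F₁) (hF₁neg : ∀ x ≤ (0:ℝ), F₁ x = 0)
    (hF₁cont : Continuous F₁)
    -- convolution equation F = F₁ * f
    (hconv : ∀ r ≥ (0:ℝ), F r = ∫ x in (0:ℝ)..r, F₁ (r - x) * f x)
    -- differentiability of F(x)·exp(x/(2λ₁)) on the positive half-line
    (hdiff : ∀ x > (0:ℝ), DifferentiableAt ℝ (fun y => F y * Real.exp (y / (2 * lam1))) x) :
    ∀ r ≥ (0:ℝ),
      F₁ r = Real.sqrt (2 * lam1 / π) * Real.exp (-r / (2 * lam1)) *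
        ∫ x in (0:ℝ)..r,
          deriv (fun y => F y * Real.exp (y / (2 * lam1))) x / Real.sqrt (r - x) := by
  intro r hr
  have hnonneg : ∀ x, 0 ≤ F₁ x := fun x => by
    rcases le_total x 0 with h | h
    · rw [hF₁neg x h]
    · rw [← hF₁neg 0 le_rfl]; exact hF₁mono h
  set c := √(2 * π * lam1) with hc
  have hcpos : 0 < c := Real.sqrt_pos.2 (by positivity)
  have habel := integral_deriv_div_sqrt_eq_of_abel
    (g := fun y => F₁ y * exp (y / (2 * lam1)))
    (G := fun y => c * (F y * exp (y / (2 * lam1))))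
    (hF₁mono.mul (fun x y hxy => exp_le_exp.2 (by gcongr)) hnonneg fun x => (exp_pos _).le)
    (by fun_prop) (fun x hx => by simp [hF₁neg x hx])
    (fun y hy => by
      rw [hconv y hy, ← intervalIntegral.integral_mul_const, ← intervalIntegral.integral_const_mul]
      refine intervalIntegral.integral_congr_ae (Filter.Eventually.of_forall fun x hx => ?_)
      rw [Set.uIoc_of_le hy] at hx
      have hx0 : √x ≠ 0 := (Real.sqrt_pos.2 hx.1).ne'
      have he : exp ((y - x) / (2 * lam1)) =
          exp (-x / (2 * lam1)) * exp (y / (2 * lam1)) := by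
        rw [← exp_add]; congr 1; ring
      rw [hf x hx.1, Real.sqrt_mul (by positivity), ← hc, he]
      field_simp) hr
  simp only [deriv_const_mul_field', mul_div_assoc, intervalIntegral.integral_const_mul] at habel
  have hI := (eq_div_iff hcpos.ne').2 ((mul_comm _ _).trans habel)
  have hk : √(2 * lam1 / π) * π = c := by
    rw [hc, ← Real.sqrt_sq (mul_nonneg (Real.sqrt_nonneg (2 * lam1 / π)) pi_pos.le), mul_pow,
      Real.sq_sqrt (by positivity)]
    congr 1
    field_simp
  have he : exp (-r / (2 * lam1)) * exp (r / (2 * lam1)) = 1 := by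
    rw [← exp_add, neg_div, neg_add_cancel, exp_zero]
  rw [hI]
  calc F₁ r = c / c * (exp (-r / (2 * lam1)) * exp (r / (2 * lam1))) * F₁ r := by
        rw [he, div_self hcpos.ne']; ring
    _ = _ := by
        rw [← hk]; ring
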